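/- For all positive integers d and p, the star K_{1,k} with k = C(d,p) + 1 leaves (where C(d,p) is the binomial coefficient d choose p) is a minimal forbidden induced subgraph for the class 𝒢(d,p): it satisfies Θ_p(K_{1,k}) > d, while every proper induced subgraph G of K_{1,k} satisfies Θ_p(G) ≤ d. -/

import Mathlib

/-- The `p`-intersection number `Θ_p(G)`. -/
noncomputable def SimpleGraph.pIntersectionNumber {V : Type*} (G : SimpleGraph V)
    (p : ℕ) : ℕ :=
  sInf {d : ℕ | ∃ S : V → Finset (Fin d),
    ∀ u v : V, u ≠ v → (G.Adj u v ↔ p ≤ (S u ∩ S v).card)}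

/-- The star `K_{1,k}`: the center `none` is adjacent to the `k` leaves `some i`,
and the leaves are pairwise nonadjacent. -/
def starGraph (k : ℕ) : SimpleGraph (Option (Fin k)) :=
  SimpleGraph.fromRel (fun u v => u = none ∧ v ≠ none)

theorem starGraph_adj_none_some {k : ℕ} (i : Fin k) : (starGraph k).Adj none (some i) := by
  simp [starGraph]

theorem starGraph_not_adj_some_some {k : ℕ} (i j : Fin k) :
    ¬ (starGraph k).Adj (some i) (some j) := by
  simp [starGraph]

/-- Distinct `p`-element sets meet in fewer than `p` elements. -/
theorem Finset.card_inter_lt_of_card_eq {α : Type*} [DecidableEq α] {A B : Finset α} {p : ℕ}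
    (hA : A.card = p) (hB : B.card = p) (hne : A ≠ B) : (A ∩ B).card < p := by
  by_contra! h
  have hAB : A ∩ B = A := Finset.eq_of_subset_of_card_le Finset.inter_subset_left (by omega)
  have hBA : A ∩ B = B := Finset.eq_of_subset_of_card_le Finset.inter_subset_right (by omega)
  exact hne (hAB.symm.trans hBA)

/-- If `C(n,p)` is at least the size of `A`, the star restricted to its center and the leaves in
`A` has a `p`-intersection representation on `Fin n`. -/
theorem starGraph_exists_representation {k n p : ℕ} (A : Finset (Fin k))
    (hA : A.card ≤ n.choose p) :
    ∃ S : Option (Fin k) → Finset (Fin n), ∀ u v : Option (Fin k),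
      (∀ i, u = some i → i ∈ A) → (∀ i, v = some i → i ∈ A) → u ≠ v →
        ((starGraph k).Adj u v ↔ p ≤ (S u ∩ S v).card) := by
  obtain ⟨T, hT, hinj⟩ := A.finite_toSet.exists_injOn_of_encard_le
    (t := (Finset.powersetCard p (Finset.univ : Finset (Fin n)) : Set (Finset (Fin n))))
    (by
      rw [Set.encard_coe_eq_coe_finsetCard, Set.encard_coe_eq_coe_finsetCard,
        Finset.card_powersetCard, Finset.card_fin]
      exact_mod_cast hA)
  have hcard : ∀ i ∈ A, (T i).card = p := fun i hi => by
    have h := Set.mem_preimage.1 (hT (Finset.mem_coe.2 hi))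
    exact (Finset.mem_powersetCard.1 (Finset.mem_coe.1 h)).2
  refine ⟨fun u => u.elim Finset.univ T, ?_⟩
  rintro (_ | i) (_ | j) hu hv huv
  · exact absurd rfl huv
  · simp [starGraph_adj_none_some, hcard j (hv j rfl)]
  · simp [(starGraph_adj_none_some i).symm, hcard i (hu i rfl)]
  · have hi := hu i rfl
    have hj := hv j rfl
    have hne : T i ≠ T j := fun h => huv (congrArg some (hinj hi hj h))
    have hlt := Finset.card_inter_lt_of_card_eq (hcard i hi) (hcard j hj) hne
    simpa [starGraph_not_adj_some_some] using hlt

/-- A star with a `p`-intersection representation on `Fin n` has at most `C(n,p)` leaves. -/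
theorem le_choose_of_starGraph_representation {k n p : ℕ} (S : Option (Fin k) → Finset (Fin n))
    (hS : ∀ u v, u ≠ v → ((starGraph k).Adj u v ↔ p ≤ (S u ∩ S v).card)) :
    k ≤ n.choose p := by
  have hsub : ∀ i : Fin k, ∃ T ⊆ S none ∩ S (some i), T.card = p := fun i =>
    Finset.exists_subset_card_eq ((hS none (some i) (by simp)).1 (starGraph_adj_none_some i))
  choose T hT hcard using hsub
  have hinj : Function.Injective T := by
    intro i j hij
    by_contra hne
    refine starGraph_not_adj_some_some i j ((hS (some i) (some j) (by simpa using hne)).2 ?_)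
    rw [← hcard i]
    refine Finset.card_le_card (Finset.subset_inter ?_ ?_)
    · exact (hT i).trans Finset.inter_subset_right
    · rw [hij]
      exact (hT j).trans Finset.inter_subset_right
  have h := Finset.card_le_card_of_injOn (s := Finset.univ)
    (t := Finset.powersetCard p (Finset.univ : Finset (Fin n))) T
    (fun i _ => by simp [hcard i]) hinj.injOn
  simpa using h

theorem le_choose_add_self (k : ℕ) {p : ℕ} (hp : 0 < p) : k ≤ (k + p).choose p := by
  calc k ≤ (k + 1).choose k := by simp
    _ ≤ (k + p).choose k := Nat.choose_le_choose k (by omega)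
    _ = (k + p).choose p := Nat.choose_symm_add

/-- Theorem 2: for positive integers `d` and `p`, the star `K_{1,k}` with
`k = C(d,p) + 1` is a minimal forbidden induced subgraph for `𝒢(d,p)`:
its `p`-intersection number exceeds `d`, while every proper induced subgraph has
`p`-intersection number at most `d`. -/
theorem star_minimal_forbidden (d p : ℕ) (hd : 0 < d) (hp : 0 < p) :
    d < (starGraph (d.choose p + 1)).pIntersectionNumber p ∧
    ∀ s : Set (Option (Fin (d.choose p + 1))), s ≠ Set.univ →
      ((starGraph (d.choose p + 1)).induce s).pIntersectionNumber p ≤ d := by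
  constructor
  · by_contra! hle
    have hne : {n : ℕ | ∃ S : Option (Fin (d.choose p + 1)) → Finset (Fin n),
        ∀ u v, u ≠ v → ((starGraph (d.choose p + 1)).Adj u v ↔ p ≤ (S u ∩ S v).card)}.Nonempty := by
      obtain ⟨S, hS⟩ := starGraph_exists_representation
        (Finset.univ : Finset (Fin (d.choose p + 1)))
        (by simpa using le_choose_add_self (d.choose p + 1) hp)
      exact ⟨_, S, fun u v => hS u v (by simp) (by simp)⟩
    obtain ⟨S, hS⟩ := Nat.sInf_mem hne
    have hk := le_choose_of_starGraph_representation S hS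
    have hmono := Nat.choose_le_choose p hle
    unfold SimpleGraph.pIntersectionNumber at hmono
    omega
  · intro s hs
    refine Nat.sInf_le ?_
    obtain ⟨x, hx⟩ := (Set.ne_univ_iff_exists_notMem s).1 hs
    rcases x with _ | j
    · refine ⟨fun _ => ∅, ?_⟩
      rintro ⟨_ | i, hi⟩ ⟨_ | j, hj⟩ -
      · exact absurd hi hx
      · exact absurd hi hx
      · exact absurd hj hx
      · simp [starGraph_not_adj_some_some, hp.ne']
    · obtain ⟨S, hS⟩ := starGraph_exists_representation (n := d) (p := p)
        (Finset.univ.erase j) (by simp)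
      have hmem : ∀ u ∈ s, ∀ i, u = some i → i ∈ Finset.univ.erase j := by
        rintro u hu i rfl
        simp only [Finset.mem_erase, Finset.mem_univ, and_true]
        rintro rfl
        exact hx hu
      exact ⟨fun u => S u, fun u v huv =>
        hS u v (hmem u u.2) (hmem v v.2) (fun h => huv (Subtype.ext h))⟩
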